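/- Under the setting of the Poisson likelihood with Gamma-mixture prior π(λ) = p·Gamma(α₁, β) + (1−p)·Gamma(α₁+α₂, β) (α₁, α₂, β > 0, p ∈ (0,1)) and observations n₁,…,n_m ∈ ℕ with S = Σ_{j=1}^m n_j, the posterior mean of Λ (the Bayesian pure premium for the frequency component) equals E[Λ | n₁,…,n_m] = ∫₀^∞ λ π(λ | n) dλ = w · (S+α₁)/(β+m) + (1−w) · (S+α₁+α₂)/(β+m), where w = 1/(1+G) and G = ((1−p)/p) · (B(α₁, α₂)/B(S+α₁, α₂)) · (β/(β+m))^{α₂}. -/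

import Mathlib

open MeasureTheory Real Set Finset

/-- The unnormalized Gamma density is integrable on `(0, ∞)`. -/
lemma integrableOn_rpow_sub_one_mul_exp_neg_mul_Ioi {a r : ℝ} (ha : 0 < a) (hr : 0 < r) :
    IntegrableOn (fun t : ℝ => t ^ (a - 1) * Real.exp (-(r * t))) (Ioi 0) := by
  by_contra h
  have h0 := integral_undef h
  rw [Real.integral_rpow_mul_exp_neg_mul_Ioi ha hr] at h0
  have := Real.Gamma_pos_of_pos ha
  have : 0 < (1 / r) ^ a * Real.Gamma a := by positivity
  exact this.ne' h0

/-- Total mass of a linear combination of two unnormalized Gamma densities with common rate. -/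
lemma integral_gamma_mixture_Ioi {a b r : ℝ} (ha : 0 < a) (hb : 0 < b) (hr : 0 < r) (c d : ℝ) :
    ∫ t in Ioi (0 : ℝ), (c * (t ^ (a - 1) * Real.exp (-(r * t)))
        + d * (t ^ (b - 1) * Real.exp (-(r * t))))
      = c * ((1 / r) ^ a * Real.Gamma a) + d * ((1 / r) ^ b * Real.Gamma b) := by
  rw [integral_add ((integrableOn_rpow_sub_one_mul_exp_neg_mul_Ioi ha hr).const_mul c)
    ((integrableOn_rpow_sub_one_mul_exp_neg_mul_Ioi hb hr).const_mul d),
    integral_const_mul, integral_const_mul, Real.integral_rpow_mul_exp_neg_mul_Ioi ha hr,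
    Real.integral_rpow_mul_exp_neg_mul_Ioi hb hr]

/-- The Poisson likelihood depends on the rate only through the sample size and the total count. -/
lemma prod_poisson_likelihood {m : ℕ} (n : Fin m → ℕ) (t : ℝ) :
    ∏ j, Real.exp (-t) * t ^ (n j) / ((n j).factorial : ℝ)
      = (∏ j, ((n j).factorial : ℝ))⁻¹ * (Real.exp (-(m * t)) * t ^ (∑ j, n j)) := by
  rw [Finset.prod_div_distrib, Finset.prod_mul_distrib, Finset.prod_pow_eq_pow_sum,
    Finset.prod_const, ← Real.exp_nat_mul, Finset.card_univ, Fintype.card_fin, div_eq_inv_mul,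
    mul_neg]

/-- **Bayesian pure premium for the frequency component.**
With prior `π(λ) = p·Gamma(α₁,β) + (1-p)·Gamma(α₁+α₂,β)` density and Poisson observations
`n₁,…,n_m` with `S = Σⱼ nⱼ`, the posterior mean of `Λ` is
`E[Λ|n] = ∫₀^∞ λ π(λ|n) dλ = w·(S+α₁)/(β+m) + (1-w)·(S+α₁+α₂)/(β+m)`,
where `w = 1/(1+G)` and `G = ((1-p)/p)(B(α₁,α₂)/B(S+α₁,α₂))(β/(β+m))^{α₂}`. -/
theorem bayesian_premium_frequency
    (α₁ α₂ β p : ℝ) (hα₁ : 0 < α₁) (hα₂ : 0 < α₂) (hβ : 0 < β)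
    (hp : 0 < p) (hp1 : p < 1)
    (m : ℕ) (n : Fin m → ℕ) (S : ℕ) (hS : S = ∑ j, n j)
    (B : ℝ → ℝ → ℝ)
    (hB : ∀ a b : ℝ, B a b = Real.Gamma a * Real.Gamma b / Real.Gamma (a + b))
    (G w : ℝ)
    (hG : G = ((1 - p) / p) * (B α₁ α₂ / B (S + α₁) α₂) * (β / (β + m)) ^ α₂)
    (hw : w = 1 / (1 + G))
    (prior : ℝ → ℝ)
    (hprior : ∀ l : ℝ, prior l =
        p * (l ^ (α₁ - 1) * β ^ α₁ * Real.exp (-β * l) / Real.Gamma α₁)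
          + (1 - p) * (l ^ (α₁ + α₂ - 1) * β ^ (α₁ + α₂) * Real.exp (-β * l) /
              Real.Gamma (α₁ + α₂)))
    (post : ℝ → ℝ)
    (hpost : ∀ l : ℝ, post l =
        prior l * (∏ j, Real.exp (-l) * l ^ (n j) / ((n j).factorial : ℝ)) /
          ∫ t in Ioi (0 : ℝ),
            prior t * ∏ j, Real.exp (-t) * t ^ (n j) / ((n j).factorial : ℝ)) :
    ∫ l in Ioi (0 : ℝ), l * post l
      = w * ((S + α₁) / (β + m)) + (1 - w) * ((S + α₁ + α₂) / (β + m)) := by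
  set a : ℝ := S + α₁ with ha_def
  set r : ℝ := β + m with hr_def
  have ha : 0 < a := by positivity
  have hr : 0 < r := by positivity
  have hq : 0 < 1 - p := by linarith
  have hΓ₁ := Real.Gamma_pos_of_pos hα₁
  have hΓ₂ := Real.Gamma_pos_of_pos hα₂
  have hΓ₁₂ := Real.Gamma_pos_of_pos (add_pos hα₁ hα₂)
  have hΓa := Real.Gamma_pos_of_pos ha
  have hΓb := Real.Gamma_pos_of_pos (add_pos ha hα₂)
  set K : ℝ := (∏ j, ((n j).factorial : ℝ))⁻¹ with hK_def
  have hK : 0 < K := by positivity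
  set c : ℝ := p * β ^ α₁ / Real.Gamma α₁ with hc_def
  set d : ℝ := (1 - p) * β ^ (α₁ + α₂) / Real.Gamma (α₁ + α₂) with hd_def
  have hc : 0 < c := by positivity
  have hd : 0 < d := by positivity
  have joint : ∀ t ∈ Ioi (0 : ℝ),
      prior t * ∏ j, Real.exp (-t) * t ^ (n j) / ((n j).factorial : ℝ)
        = K * c * (t ^ (a - 1) * Real.exp (-(r * t)))
          + K * d * (t ^ (a + α₂ - 1) * Real.exp (-(r * t))) := by
    intro t ht
    have ht : 0 < t := ht
    have e₁ : t ^ (a - 1) = t ^ S * t ^ (α₁ - 1) := by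
      rw [← Real.rpow_natCast, ← Real.rpow_add ht, ha_def, add_sub_assoc]
    have e₂ : t ^ (a + α₂ - 1) = t ^ S * t ^ (α₁ + α₂ - 1) := by
      rw [← Real.rpow_natCast, ← Real.rpow_add ht, ha_def]
      ring_nf
    have e₃ : Real.exp (-(r * t)) = Real.exp (-β * t) * Real.exp (-(m * t)) := by
      rw [← Real.exp_add, hr_def]
      ring_nf
    rw [prod_poisson_likelihood, ← hS, hprior, e₁, e₂, e₃, hc_def, hd_def]
    ring
  have evidence := (setIntegral_congr_fun measurableSet_Ioi joint).trans
    (integral_gamma_mixture_Ioi ha (add_pos ha hα₂) hr (K * c) (K * d))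
  set x : ℝ := (1 / r) ^ a * Real.Gamma a with hx_def
  set y : ℝ := (1 / r) ^ (a + α₂) * Real.Gamma (a + α₂) with hy_def
  have hx : 0 < x := by positivity
  have hy : 0 < y := by positivity
  have moment : ∀ s : ℝ, 0 < s →
      (1 / r) ^ (s + 1) * Real.Gamma (s + 1) = (1 / r) ^ s * Real.Gamma s * (s / r) := by
    intro s hs
    rw [Real.rpow_add_one (by positivity), Real.Gamma_add_one hs.ne']
    ring
  have first : ∀ t ∈ Ioi (0 : ℝ), t * post t
      = K * c / (K * c * x + K * d * y) * (t ^ (a + 1 - 1) * Real.exp (-(r * t)))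
        + K * d / (K * c * x + K * d * y) *
          (t ^ (a + α₂ + 1 - 1) * Real.exp (-(r * t))) := by
    intro t ht
    have ht' : t ≠ 0 := ne_of_gt ht
    have shift : ∀ s : ℝ, t ^ (s + 1 - 1) = t ^ (s - 1) * t := by
      intro s
      rw [← Real.rpow_add_one ht']
      ring_nf
    rw [hpost, evidence, joint t ht, shift, shift]
    ring
  have odds : G = d * y / (c * x) := by
    rw [hG, hB, hB, hc_def, hd_def, hx_def, hy_def, Real.rpow_add hβ,
      Real.rpow_add (by positivity : 0 < 1 / r), div_eq_mul_one_div β r,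
      Real.mul_rpow hβ.le (by positivity)]
    field_simp
  rw [setIntegral_congr_fun measurableSet_Ioi first,
    integral_gamma_mixture_Ioi (by positivity) (by positivity) hr, moment a ha,
    moment (a + α₂) (by positivity), ← hx_def, ← hy_def, hw, odds]
  have hne : c * x + d * y ≠ 0 := by positivity
  field_simp
  ring
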